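/- Let V = {([x₀:x₁],[y₀:y₁],[z₀:z₁]) ∈ ℙ¹(ℝ)×ℙ¹(ℝ)×ℙ¹(ℝ) : x₀y₀z₁ + x₀y₁z₀ + x₁y₀z₀ − x₁y₁z₁ = 0}. The maps α₁(x,y,z) = (y,x,z) and α₂(x,y,z) = ([z₁:z₀],[x₀:−x₁],[y₁:y₀]) are well-defined bijections of V; α₁ has order 2, α₂ has order exactly 6, (α₂α₁)² = id, and the subgroup of the symmetric group of V generated by α₁ and α₂ is isomorphic to the dihedral group D₆ of order 12. -/

import Mathlib

/-- The real del Pezzo surface of degree 6 obtained by blowing up `ℙ¹ × ℙ¹` in a pair of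
non-real conjugate points:
`V = {([x₀:x₁],[y₀:y₁],[z₀:z₁]) ∈ ℙ¹ × ℙ¹ × ℙ¹ : x₀y₀z₁ + x₀y₁z₀ + x₁y₀z₀ − x₁y₁z₁ = 0}`. -/
def V6 : Set (Projectivization ℝ (Fin 2 → ℝ) × Projectivization ℝ (Fin 2 → ℝ) ×
    Projectivization ℝ (Fin 2 → ℝ)) :=
  {P | ∃ (x₀ x₁ y₀ y₁ z₀ z₁ : ℝ) (hx : (![x₀, x₁] : Fin 2 → ℝ) ≠ 0)
      (hy : (![y₀, y₁] : Fin 2 → ℝ) ≠ 0) (hz : (![z₀, z₁] : Fin 2 → ℝ) ≠ 0),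
      P.1 = Projectivization.mk ℝ ![x₀, x₁] hx ∧
      P.2.1 = Projectivization.mk ℝ ![y₀, y₁] hy ∧
      P.2.2 = Projectivization.mk ℝ ![z₀, z₁] hz ∧
      x₀ * y₀ * z₁ + x₀ * y₁ * z₀ + x₁ * y₀ * z₀ - x₁ * y₁ * z₁ = 0}

namespace DihedralGroup

variable {G : Type*} [Group G] {n : ℕ} {a b : G}

/-- The homomorphism out of a dihedral group given by the images `b` of the rotation `r 1` and
`a` of the reflection `sr 0`, subject to the dihedral relations. -/
def liftHom (a b : G) (ha : a ^ 2 = 1) (hb : b ^ n = 1) (hba : (b * a) ^ 2 = 1) :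
    DihedralGroup n →* G :=
  have cast_zpow (k : ℤ) : b ^ ((k : ZMod n).cast : ℤ) = b ^ k := by
    rw [zpow_eq_zpow_iff_modEq]
    refine Int.ModEq.of_dvd (Int.natCast_dvd_natCast.2 (orderOf_dvd_of_pow_eq_one hb)) ?_
    rw [← ZMod.intCast_eq_intCast_iff, ZMod.intCast_zmod_cast]
  have conj (k : ℤ) : b ^ k * a = a * b ^ (-k) := by
    have ha' : a⁻¹ = a := inv_eq_of_mul_eq_one_left (by rwa [← sq])
    have h : a * b * a⁻¹ = b⁻¹ := by
      have hba' : (b * a)⁻¹ = b * a := inv_eq_of_mul_eq_one_left (by rwa [← sq])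
      rw [ha', mul_assoc, ← hba', mul_inv_rev, mul_inv_cancel_left]
    rw [zpow_neg, ← inv_zpow, ← h, conj_zpow]
    simp [← mul_assoc, ← sq, ha, ha']
  { toFun := fun
      | r i => b ^ (i.cast : ℤ)
      | sr i => a * b ^ (i.cast : ℤ)
    map_one' := by
      change b ^ ((0 : ZMod n).cast : ℤ) = 1
      simp
    map_mul' := by
      rintro (i | i) (j | j) <;>
      obtain ⟨i, rfl⟩ := ZMod.intCast_surjective i <;>
      obtain ⟨j, rfl⟩ := ZMod.intCast_surjective j
      · simp only [r_mul_r, ← Int.cast_add, cast_zpow, zpow_add]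
      · simp only [r_mul_sr, ← Int.cast_sub, cast_zpow]
        rw [← mul_assoc, conj, mul_assoc, ← zpow_add, neg_add_eq_sub]
      · simp only [sr_mul_r, ← Int.cast_add, cast_zpow, zpow_add, mul_assoc]
      · simp only [sr_mul_sr, ← Int.cast_sub, cast_zpow]
        rw [mul_assoc, ← mul_assoc (b ^ i), conj, mul_assoc, ← mul_assoc, ← sq, ha, one_mul,
          ← zpow_add, neg_add_eq_sub] }

variable (ha : a ^ 2 = 1) (hb : b ^ n = 1) (hba : (b * a) ^ 2 = 1)

theorem liftHom_r (i : ZMod n) : liftHom a b ha hb hba (r i) = b ^ (i.cast : ℤ) := rfl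

theorem liftHom_sr (i : ZMod n) : liftHom a b ha hb hba (sr i) = a * b ^ (i.cast : ℤ) := rfl

theorem liftHom_r_one : liftHom a b ha hb hba (r 1) = b := by
  rw [liftHom_r, ← zpow_one b, ← zpow_mul, one_mul, zpow_eq_zpow_iff_modEq]
  refine Int.ModEq.of_dvd (Int.natCast_dvd_natCast.2 (orderOf_dvd_of_pow_eq_one hb)) ?_
  rw [← ZMod.intCast_eq_intCast_iff, ZMod.intCast_zmod_cast, Int.cast_one]

theorem range_liftHom : (liftHom a b ha hb hba).range = Subgroup.closure {a, b} := by
  have hmem_a : a ∈ Subgroup.closure {a, b} := Subgroup.subset_closure (by simp)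
  have hmem_b : b ∈ Subgroup.closure {a, b} := Subgroup.subset_closure (by simp)
  apply le_antisymm
  · rintro _ ⟨i | i, rfl⟩
    · exact zpow_mem hmem_b _
    · exact mul_mem hmem_a (zpow_mem hmem_b _)
  · rw [Subgroup.closure_le]
    rintro _ (rfl | rfl)
    · exact ⟨sr 0, by simp [liftHom_sr]⟩
    · exact ⟨r 1, liftHom_r_one ha hb hba⟩

theorem liftHom_injective (hord : orderOf b = n) (hn : ¬ n ∣ 2) :
    Function.Injective (liftHom a b ha hb hba) := by
  rw [injective_iff_map_eq_one]
  rintro (i | i) h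
  · rw [liftHom_r, ← orderOf_dvd_iff_zpow_eq_one, hord, ← ZMod.intCast_zmod_eq_zero_iff_dvd,
      ZMod.intCast_zmod_cast] at h
    rw [h, r_zero]
  · rw [liftHom_sr, ← eq_inv_iff_mul_eq_one, ← zpow_neg] at h
    have hcomm : Commute b a := h ▸ Commute.self_zpow b _
    rw [hcomm.mul_pow, ha, mul_one] at hba
    exact absurd (hord ▸ orderOf_dvd_of_pow_eq_one hba) hn

/-- A subgroup generated by two elements satisfying the dihedral relations, with the rotation of
order exactly `n`, is a dihedral group. -/
theorem nonempty_closure_mulEquiv (ha : a ^ 2 = 1) (hba : (b * a) ^ 2 = 1) (hord : orderOf b = n)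
    (hn : ¬ n ∣ 2) : Nonempty (Subgroup.closure {a, b} ≃* DihedralGroup n) := by
  have hb : b ^ n = 1 := hord ▸ pow_orderOf_eq_one b
  rw [← range_liftHom ha hb hba]
  exact ⟨(MonoidHom.ofInjective (liftHom_injective ha hb hba hord hn)).symm⟩

end DihedralGroup

/-- The involution `[x₀ : x₁] ↦ [x₁ : x₀]` of the projective line. -/
noncomputable def projSwap : Projectivization ℝ (Fin 2 → ℝ) → Projectivization ℝ (Fin 2 → ℝ) :=
  Projectivization.map _ (LinearEquiv.funCongrLeft ℝ ℝ (Equiv.swap (0 : Fin 2) 1)).injective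

/-- The involution `[x₀ : x₁] ↦ [x₀ : -x₁]` of the projective line. -/
noncomputable def projNeg : Projectivization ℝ (Fin 2 → ℝ) → Projectivization ℝ (Fin 2 → ℝ) :=
  Projectivization.map _ (LinearEquiv.piCongrRight
    (![LinearEquiv.refl ℝ ℝ, LinearEquiv.neg ℝ] : Fin 2 → ℝ ≃ₗ[ℝ] ℝ)).injective

theorem Projectivization.exists_eq_mk_pair (p : Projectivization ℝ (Fin 2 → ℝ)) :
    ∃ (x y : ℝ) (h : (![x, y] : Fin 2 → ℝ) ≠ 0), p = Projectivization.mk ℝ ![x, y] h := by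
  induction p with
  | h v hv =>
    have hv' : v = ![v 0, v 1] := by
      ext i; fin_cases i <;> rfl
    refine ⟨v 0, v 1, hv' ▸ hv, ?_⟩
    congr 1

theorem pair_swap_ne_zero {x y : ℝ} (h : (![x, y] : Fin 2 → ℝ) ≠ 0) :
    (![y, x] : Fin 2 → ℝ) ≠ 0 := by
  contrapose! h
  simp_all

theorem pair_neg_ne_zero {x y : ℝ} (h : (![x, y] : Fin 2 → ℝ) ≠ 0) :
    (![x, -y] : Fin 2 → ℝ) ≠ 0 := by
  contrapose! h
  simp_all

theorem projSwap_mk {x y : ℝ} (h : (![x, y] : Fin 2 → ℝ) ≠ 0) :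
    projSwap (Projectivization.mk ℝ ![x, y] h) =
      Projectivization.mk ℝ ![y, x] (pair_swap_ne_zero h) := by
  rw [projSwap, Projectivization.map_mk]
  congr 1
  ext i; fin_cases i <;> simp [LinearMap.funLeft]

theorem projNeg_mk {x y : ℝ} (h : (![x, y] : Fin 2 → ℝ) ≠ 0) :
    projNeg (Projectivization.mk ℝ ![x, y] h) =
      Projectivization.mk ℝ ![x, -y] (pair_neg_ne_zero h) := by
  rw [projNeg, Projectivization.map_mk]
  congr 1
  ext i; fin_cases i <;> simp

theorem projSwap_projSwap (p : Projectivization ℝ (Fin 2 → ℝ)) : projSwap (projSwap p) = p := by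
  obtain ⟨x, y, h, rfl⟩ := p.exists_eq_mk_pair
  simp only [projSwap_mk]

theorem projNeg_projNeg (p : Projectivization ℝ (Fin 2 → ℝ)) : projNeg (projNeg p) = p := by
  obtain ⟨x, y, h, rfl⟩ := p.exists_eq_mk_pair
  simp only [projNeg_mk, neg_neg]

theorem projSwap_projNeg (p : Projectivization ℝ (Fin 2 → ℝ)) :
    projSwap (projNeg p) = projNeg (projSwap p) := by
  obtain ⟨x, y, h, rfl⟩ := p.exists_eq_mk_pair
  simp only [projNeg_mk, projSwap_mk]
  rw [Projectivization.mk_eq_mk_iff']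
  exact ⟨-1, by simp⟩

namespace V6

theorem swap_mem {x y z : Projectivization ℝ (Fin 2 → ℝ)} (h : (x, y, z) ∈ V6) :
    (y, x, z) ∈ V6 := by
  obtain ⟨x₀, x₁, y₀, y₁, z₀, z₁, hx, hy, hz, h₁, h₂, h₃, h⟩ := h
  exact ⟨y₀, y₁, x₀, x₁, z₀, z₁, hy, hx, hz, h₂, h₁, h₃, by linarith⟩

theorem rotate_mem {x y z : Projectivization ℝ (Fin 2 → ℝ)} (h : (x, y, z) ∈ V6) :
    (projSwap z, projNeg x, projSwap y) ∈ V6 := by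
  obtain ⟨x₀, x₁, y₀, y₁, z₀, z₁, hx, hy, hz, rfl, rfl, rfl, h⟩ := h
  exact ⟨z₁, z₀, x₀, -x₁, y₁, y₀, pair_swap_ne_zero hz, pair_neg_ne_zero hx, pair_swap_ne_zero hy,
    projSwap_mk hz, projNeg_mk hx, projSwap_mk hy, by linarith⟩

theorem rotate_symm_mem {x y z : Projectivization ℝ (Fin 2 → ℝ)} (h : (x, y, z) ∈ V6) :
    (projNeg y, projSwap z, projSwap x) ∈ V6 := by
  obtain ⟨x₀, x₁, y₀, y₁, z₀, z₁, hx, hy, hz, rfl, rfl, rfl, h⟩ := h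
  exact ⟨y₀, -y₁, z₁, z₀, x₁, x₀, pair_neg_ne_zero hy, pair_swap_ne_zero hz, pair_swap_ne_zero hx,
    projNeg_mk hy, projSwap_mk hz, projSwap_mk hx, by linarith⟩

/-- The reflection `(x, y, z) ↦ (y, x, z)` of the surface. -/
def reflection : Equiv.Perm V6 where
  toFun p := ⟨(p.1.2.1, p.1.1, p.1.2.2), swap_mem p.2⟩
  invFun p := ⟨(p.1.2.1, p.1.1, p.1.2.2), swap_mem p.2⟩
  left_inv _ := rfl
  right_inv _ := rfl

/-- The rotation `(x, y, z) ↦ ([z₁ : z₀], [x₀ : -x₁], [y₁ : y₀])` of the surface. -/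
noncomputable def rotation : Equiv.Perm V6 where
  toFun p := ⟨(projSwap p.1.2.2, projNeg p.1.1, projSwap p.1.2.1), rotate_mem p.2⟩
  invFun p := ⟨(projNeg p.1.2.1, projSwap p.1.2.2, projSwap p.1.1), rotate_symm_mem p.2⟩
  left_inv p := by ext1; simp [projSwap_projSwap, projNeg_projNeg]
  right_inv p := by ext1; simp [projSwap_projSwap, projNeg_projNeg]

theorem reflection_apply (p : V6) : (reflection p).1 = (p.1.2.1, p.1.1, p.1.2.2) := rfl

theorem rotation_apply (p : V6) :
    (rotation p).1 = (projSwap p.1.2.2, projNeg p.1.1, projSwap p.1.2.1) := rfl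

theorem rotation_sq_apply (p : V6) :
    ((rotation ^ 2) p).1 =
      (p.1.2.1, projNeg (projSwap p.1.2.2), projNeg (projSwap p.1.1)) := by
  simp [sq, rotation_apply, projSwap_projSwap, projSwap_projNeg]

theorem rotation_cube_apply (p : V6) :
    ((rotation ^ 3) p).1 = (projNeg p.1.1, projNeg p.1.2.1, projNeg p.1.2.2) := by
  rw [pow_succ', Equiv.Perm.mul_apply, rotation_apply, rotation_sq_apply]
  simp [projSwap_projSwap, projSwap_projNeg]

/-- The point `([1 : 0], [1 : 1], [1 : -1])` of the surface. -/
noncomputable def basePoint : V6 :=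
  ⟨(Projectivization.mk ℝ ![1, 0] (by simp), Projectivization.mk ℝ ![1, 1] (by simp),
    Projectivization.mk ℝ ![1, -1] (by simp)),
    1, 0, 1, 1, 1, -1, by simp, by simp, by simp, rfl, rfl, rfl, by norm_num⟩

theorem basePoint_fst_ne_snd : basePoint.1.1 ≠ basePoint.1.2.1 := by
  simp [basePoint, Projectivization.mk_eq_mk_iff']

theorem projNeg_basePoint_ne : projNeg basePoint.1.2.1 ≠ basePoint.1.2.1 := by
  simp only [basePoint, projNeg_mk, ne_eq, Projectivization.mk_eq_mk_iff', not_exists]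
  intro a h
  have h₀ := congrFun h 0
  have h₁ := congrFun h 1
  simp at h₀ h₁
  linarith

theorem orderOf_reflection : orderOf reflection = 2 := by
  refine orderOf_eq_prime rfl fun h => basePoint_fst_ne_snd ?_
  have := congrArg (fun f : Equiv.Perm V6 => (f basePoint).1.2.1) h
  simpa [reflection_apply] using this

theorem orderOf_rotation : orderOf rotation = 6 := by
  refine orderOf_eq_of_pow_and_pow_div_prime (by norm_num) ?_ ?_
  · ext1 p
    ext1
    rw [show 6 = 3 + 3 from rfl, pow_add, Equiv.Perm.mul_apply, rotation_cube_apply,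
      rotation_cube_apply]
    simp [projNeg_projNeg]
  · intro p hp hdvd
    have hp' : p = 2 ∨ p = 3 := by
      rw [show 6 = 2 * 3 from rfl, hp.dvd_mul] at hdvd
      simpa [Nat.prime_dvd_prime_iff_eq hp, Nat.prime_two, Nat.prime_three] using hdvd
    obtain rfl | rfl := hp'
    · refine fun h => projNeg_basePoint_ne ?_
      have := congrArg (fun f : Equiv.Perm V6 => (f basePoint).1.2.1) h
      simpa [rotation_cube_apply] using this
    · refine fun h => basePoint_fst_ne_snd ?_
      have := congrArg (fun f : Equiv.Perm V6 => (f basePoint).1.1) h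
      simpa [rotation_sq_apply] using this.symm

theorem rotation_mul_reflection_sq : (rotation * reflection) ^ 2 = 1 := by
  ext1 p
  ext1
  simp [sq, rotation_apply, reflection_apply, projSwap_projSwap, projNeg_projNeg]

end V6

/-- The maps `α₁(x,y,z) = (y,x,z)` and `α₂(x,y,z) = ([z₁:z₀],[x₀:−x₁],[y₁:y₀])` are
well-defined bijections of `V`; `α₁` has order `2`, `α₂` has order exactly `6`,
`(α₂α₁)² = id`, and the subgroup of the symmetric group of `V` generated by `α₁` and `α₂`
is isomorphic to the dihedral group `D₆` of order `12`. -/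
theorem stmt_5 :
    ∃ α₁ α₂ : Equiv.Perm V6,
      (∀ (x₀ x₁ y₀ y₁ z₀ z₁ : ℝ) (hx : (![x₀, x₁] : Fin 2 → ℝ) ≠ 0)
          (hy : (![y₀, y₁] : Fin 2 → ℝ) ≠ 0) (hz : (![z₀, z₁] : Fin 2 → ℝ) ≠ 0)
          (hmem : (Projectivization.mk ℝ ![x₀, x₁] hx,
              Projectivization.mk ℝ ![y₀, y₁] hy,
              Projectivization.mk ℝ ![z₀, z₁] hz) ∈ V6),
        (α₁ ⟨_, hmem⟩).val =
          (Projectivization.mk ℝ ![y₀, y₁] hy,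
            Projectivization.mk ℝ ![x₀, x₁] hx,
            Projectivization.mk ℝ ![z₀, z₁] hz)) ∧
      (∀ (x₀ x₁ y₀ y₁ z₀ z₁ : ℝ) (hx : (![x₀, x₁] : Fin 2 → ℝ) ≠ 0)
          (hy : (![y₀, y₁] : Fin 2 → ℝ) ≠ 0) (hz : (![z₀, z₁] : Fin 2 → ℝ) ≠ 0)
          (hz' : (![z₁, z₀] : Fin 2 → ℝ) ≠ 0) (hx' : (![x₀, -x₁] : Fin 2 → ℝ) ≠ 0)
          (hy' : (![y₁, y₀] : Fin 2 → ℝ) ≠ 0)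
          (hmem : (Projectivization.mk ℝ ![x₀, x₁] hx,
              Projectivization.mk ℝ ![y₀, y₁] hy,
              Projectivization.mk ℝ ![z₀, z₁] hz) ∈ V6),
        (α₂ ⟨_, hmem⟩).val =
          (Projectivization.mk ℝ ![z₁, z₀] hz',
            Projectivization.mk ℝ ![x₀, -x₁] hx',
            Projectivization.mk ℝ ![y₁, y₀] hy')) ∧
      orderOf α₁ = 2 ∧ orderOf α₂ = 6 ∧ (α₂ * α₁) ^ 2 = 1 ∧
      Nonempty ((Subgroup.closure {α₁, α₂} : Subgroup (Equiv.Perm V6)) ≃*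
        DihedralGroup 6) := by
  refine ⟨V6.reflection, V6.rotation, fun _ _ _ _ _ _ _ _ _ _ => rfl, ?_, V6.orderOf_reflection,
    V6.orderOf_rotation, V6.rotation_mul_reflection_sq, ?_⟩
  · intro x₀ x₁ y₀ y₁ z₀ z₁ hx hy hz _ _ _ _
    rw [V6.rotation_apply]
    simp only [projSwap_mk, projNeg_mk]
  · exact DihedralGroup.nonempty_closure_mulEquiv rfl V6.rotation_mul_reflection_sq
      V6.orderOf_rotation (by norm_num)
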